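/- arXiv:2010.12167 — 2 statements merged into one kernel-verified Lean document; each statement's English description precedes it below -/
import Mathlib

section
/- For every real number y with y ≤ 1, one has exp(y) ≤ 1 + y + (e − 2)·y², where e is Euler's number. -/
/-- On the nonpositive half-line, `exp` lies below its quadratic Taylor polynomial at `0`. -/
theorem exp_le_quadratic_of_nonpos {y : ℝ} (hy : y ≤ 0) :
    Real.exp y ≤ 1 + y + y ^ 2 / 2 := by
  have hq : 1 - y + y ^ 2 / 2 ≤ Real.exp (-y) := by
    simpa [sub_eq_add_neg] using Real.quadratic_le_exp_of_nonneg (neg_nonneg.mpr hy)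
  have hpos : 0 < 1 + y + y ^ 2 / 2 := by nlinarith [sq_nonneg (y + 1)]
  have hmul : Real.exp y * Real.exp (-y) = 1 := by
    rw [← Real.exp_add, add_neg_cancel, Real.exp_zero]
  refine le_of_mul_le_mul_right ?_ (Real.exp_pos (-y))
  calc Real.exp y * Real.exp (-y) = 1 := hmul
    _ ≤ (1 + y + y ^ 2 / 2) * (1 - y + y ^ 2 / 2) := by nlinarith [sq_nonneg (y ^ 2)]
    _ ≤ (1 + y + y ^ 2 / 2) * Real.exp (-y) := mul_le_mul_of_nonneg_left hq hpos.le

/-- The Taylor series of `exp` at `0` without its two leading terms. -/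
theorem hasSum_exp_sub_one_sub_id (x : ℝ) :
    HasSum (fun n : ℕ => x ^ (n + 2) / (n + 2).factorial) (Real.exp x - (1 + x)) := by
  have h := NormedSpace.expSeries_div_hasSum_exp x
  rw [← Real.exp_eq_exp_ℝ] at h
  simpa [Finset.sum_range_succ] using (hasSum_nat_add_iff' 2).mpr h

/-- On `[0, 1]`, the second order remainder of `exp` is at most `(e - 2) * y ^ 2`. -/
theorem exp_le_of_mem_unitInterval {y : ℝ} (h0 : 0 ≤ y) (h1 : y ≤ 1) :
    Real.exp y ≤ 1 + y + (Real.exp 1 - 2) * y ^ 2 := by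
  have h := hasSum_le (fun n : ℕ => ?_) (hasSum_exp_sub_one_sub_id y)
    ((hasSum_exp_sub_one_sub_id 1).mul_right (y ^ 2))
  · linarith
  · rw [one_pow, div_mul_eq_mul_div, one_mul]
    gcongr ?_ / _
    exact pow_le_pow_of_le_one h0 h1 (Nat.le_add_left 2 n)

/-- For every real number `y ≤ 1`, `exp y ≤ 1 + y + (e - 2) * y ^ 2`. -/
theorem stmt_8 (y : ℝ) (hy : y ≤ 1) :
    Real.exp y ≤ 1 + y + (Real.exp 1 - 2) * y ^ 2 := by
  rcases le_total y 0 with h | h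
  · nlinarith [exp_le_quadratic_of_nonpos h, Real.exp_one_gt_d9, sq_nonneg y]
  · exact exp_le_of_mem_unitInterval h hy
end

section
/- Let π_exp and q be probability distributions on A with Q(π_exp) positive definite, let γ ∈ (0,1], define p := γ·π_exp + (1−γ)·q and Q := Q(p). Let θ ∈ ℝ^D, ε ≥ 0, ω : A → ℝ with |ω(x)| ≤ ε for all x ∈ A, and g(x) := ⟨θ, x̃(x)⟩ + ω(x). Let Γ := max_{x∈A} x̃(x)ᵀ Q(π_exp)⁻¹ x̃(x). Then for every y ∈ A: | Σ_{x∈A} p(x) · g(x) · x̃(y)ᵀ Q⁻¹ x̃(x) − ⟨θ, x̃(y)⟩ | ≤ ε·Γ/γ. -/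
open Matrix

/-- The bilinear form of a weighted Gram matrix. -/
theorem dotProduct_sum_smul_vecMulVec_mulVec {A n : Type*} [Fintype A] [Fintype n]
    (p : A → ℝ) (f : A → n → ℝ) (u w : n → ℝ) :
    u ⬝ᵥ ((∑ x : A, p x • vecMulVec (f x) (f x)) *ᵥ w) =
      ∑ x : A, p x * (u ⬝ᵥ f x) * (w ⬝ᵥ f x) := by
  rw [sum_mulVec, dotProduct_sum]
  refine Finset.sum_congr rfl fun x _ => ?_
  rw [smul_mulVec, dotProduct_smul, vecMulVec_mulVec, op_smul_eq_smul, dotProduct_smul,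
    dotProduct_comm w, smul_eq_mul, smul_eq_mul]
  ring

theorem isHermitian_sum_smul_vecMulVec {A n : Type*} [Fintype A]
    (p : A → ℝ) (f : A → n → ℝ) :
    (∑ x : A, p x • vecMulVec (f x) (f x)).IsHermitian := by
  ext i j
  simp [Matrix.sum_apply, vecMulVec_apply, mul_comm]

/-- If `γ M ≤ N` as quadratic forms, then `γ N⁻¹ ≤ M⁻¹` as quadratic forms. -/
theorem mul_dotProduct_inv_mulVec_le {n : Type*} [Fintype n] [DecidableEq n]
    {M N : Matrix n n ℝ} (hM : M.PosDef) (hN : N.PosDef) {γ : ℝ} (hγ : 0 ≤ γ)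
    (h : ∀ v, γ * (v ⬝ᵥ (M *ᵥ v)) ≤ v ⬝ᵥ (N *ᵥ v)) (x : n → ℝ) :
    γ * (x ⬝ᵥ (N⁻¹ *ᵥ x)) ≤ x ⬝ᵥ (M⁻¹ *ᵥ x) := by
  have hMx : M *ᵥ (M⁻¹ *ᵥ x) = x := by
    rw [mulVec_mulVec, mul_nonsing_inv _ ((isUnit_iff_isUnit_det M).1 hM.isUnit), one_mulVec]
  have hNx : N *ᵥ (N⁻¹ *ᵥ x) = x := by
    rw [mulVec_mulVec, mul_nonsing_inv _ ((isUnit_iff_isUnit_det N).1 hN.isUnit), one_mulVec]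
  set u := M⁻¹ *ᵥ x
  set v := N⁻¹ *ᵥ x
  have hv := h v
  rw [hNx] at hv
  have hsq := hM.posSemidef.dotProduct_mulVec_nonneg (γ • v - u)
  have hsymm : u ⬝ᵥ (M *ᵥ v) = v ⬝ᵥ x := by
    rw [dotProduct_mulVec, ← mulVec_transpose, ← conjTranspose_eq_transpose_of_trivial,
      hM.isHermitian.eq, hMx, dotProduct_comm]
  simp only [star_trivial, mulVec_sub, mulVec_smul, hMx, sub_dotProduct, dotProduct_sub,
    smul_dotProduct, dotProduct_smul, smul_eq_mul, hsymm] at hsq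
  rw [dotProduct_comm x v, dotProduct_comm x u]
  nlinarith [mul_le_mul_of_nonneg_left hv hγ]

/-- The off-diagonal entries of a positive semidefinite form are bounded by any bound on the
diagonal ones. -/
theorem Matrix.PosSemidef.abs_dotProduct_mulVec_le {n : Type*} [Fintype n]
    {M : Matrix n n ℝ} (hM : M.PosSemidef) {x y : n → ℝ} {C : ℝ}
    (hx : x ⬝ᵥ (M *ᵥ x) ≤ C) (hy : y ⬝ᵥ (M *ᵥ y) ≤ C) :
    |y ⬝ᵥ (M *ᵥ x)| ≤ C := by
  have hsymm : x ⬝ᵥ (M *ᵥ y) = y ⬝ᵥ (M *ᵥ x) := by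
    rw [dotProduct_mulVec, ← mulVec_transpose, ← conjTranspose_eq_transpose_of_trivial,
      hM.isHermitian.eq, dotProduct_comm]
  have hadd := hM.dotProduct_mulVec_nonneg (x + y)
  have hsub := hM.dotProduct_mulVec_nonneg (x - y)
  simp only [star_trivial, mulVec_add, add_dotProduct, dotProduct_add, hsymm] at hadd
  simp only [star_trivial, mulVec_sub, sub_dotProduct, dotProduct_sub, hsymm] at hsub
  rw [abs_le]
  constructor <;> linarith

/-- Bias bound for the EXP3 least-squares estimator in the misspecified linear setting:
with `p = γ π_exp + (1-γ) q`, `Q = Q(p)`, `g(x) = ⟨θ, x̃(x)⟩ + ω(x)`, `|ω| ≤ ε`, and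
`Γ = max_x x̃(x)ᵀ Q(π_exp)⁻¹ x̃(x)`, for every `y ∈ A`,
`|∑_x p(x) g(x) x̃(y)ᵀ Q⁻¹ x̃(x) - ⟨θ, x̃(y)⟩| ≤ ε Γ / γ`. -/
theorem stmt_12 {A : Type*} [Fintype A] [Nonempty A] (D : ℕ) (hD : 0 < D)
    (emb : A → Fin D → ℝ)
    (πe q : A → ℝ)
    (hπe0 : ∀ x, 0 ≤ πe x) (hπe1 : ∀ x, πe x ≤ 1) (hπesum : ∑ x : A, πe x = 1)
    (hq0 : ∀ x, 0 ≤ q x) (hq1 : ∀ x, q x ≤ 1) (hqsum : ∑ x : A, q x = 1)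
    (Qe : Matrix (Fin D) (Fin D) ℝ)
    (hQe : Qe = ∑ x : A, πe x • vecMulVec (emb x) (emb x))
    (hQepd : Qe.PosDef)
    (γ : ℝ) (hγ0 : 0 < γ) (hγ1 : γ ≤ 1)
    (p : A → ℝ) (hp : ∀ x, p x = γ * πe x + (1 - γ) * q x)
    (Q : Matrix (Fin D) (Fin D) ℝ)
    (hQ : Q = ∑ x : A, p x • vecMulVec (emb x) (emb x))
    (θ : Fin D → ℝ) (ε : ℝ) (hε : 0 ≤ ε)
    (ω : A → ℝ) (hω : ∀ x, |ω x| ≤ ε)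
    (g : A → ℝ) (hg : ∀ x, g x = θ ⬝ᵥ emb x + ω x)
    (Γ : ℝ) (hΓ : Γ = Finset.univ.sup' Finset.univ_nonempty
      (fun x : A => emb x ⬝ᵥ (Qe⁻¹ *ᵥ emb x))) :
    ∀ y : A, |(∑ x : A, p x * g x * (emb y ⬝ᵥ (Q⁻¹ *ᵥ emb x))) - θ ⬝ᵥ emb y| ≤
      ε * Γ / γ := by
  intro y
  have hp0 : ∀ x, 0 ≤ p x := fun x => by
    rw [hp]
    have := mul_nonneg (sub_nonneg.2 hγ1) (hq0 x)
    have := mul_nonneg hγ0.le (hπe0 x)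
    linarith
  have hpsum : ∑ x, p x = 1 := by
    simp only [hp, Finset.sum_add_distrib, ← Finset.mul_sum, hπesum, hqsum]
    ring
  have hle : ∀ v, γ * (v ⬝ᵥ (Qe *ᵥ v)) ≤ v ⬝ᵥ (Q *ᵥ v) := fun v => by
    rw [hQe, hQ, dotProduct_sum_smul_vecMulVec_mulVec, dotProduct_sum_smul_vecMulVec_mulVec,
      Finset.mul_sum]
    refine Finset.sum_le_sum fun x _ => ?_
    rw [hp]
    have := mul_nonneg (mul_nonneg (sub_nonneg.2 hγ1) (hq0 x)) (mul_self_nonneg (v ⬝ᵥ emb x))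
    linarith
  have hQpd : Q.PosDef := by
    refine PosDef.of_dotProduct_mulVec_pos (hQ ▸ isHermitian_sum_smul_vecMulVec p emb)
      fun v hv => ?_
    have := hQepd.dotProduct_mulVec_pos hv
    rw [star_trivial] at this ⊢
    exact (mul_pos hγ0 this).trans_le (hle v)
  have hdiag : ∀ x, emb x ⬝ᵥ (Q⁻¹ *ᵥ emb x) ≤ Γ / γ := fun x => by
    rw [le_div_iff₀' hγ0, hΓ]
    exact (mul_dotProduct_inv_mulVec_le hQepd hQpd hγ0.le hle (emb x)).trans
      (Finset.le_sup' (fun x : A => emb x ⬝ᵥ (Qe⁻¹ *ᵥ emb x)) (Finset.mem_univ x))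
  have hoff : ∀ x, |emb y ⬝ᵥ (Q⁻¹ *ᵥ emb x)| ≤ Γ / γ := fun x =>
    hQpd.inv.posSemidef.abs_dotProduct_mulVec_le (hdiag x) (hdiag y)
  have hlin : ∑ x, p x * (θ ⬝ᵥ emb x) * (emb y ⬝ᵥ (Q⁻¹ *ᵥ emb x)) = θ ⬝ᵥ emb y := by
    have hQy : Q *ᵥ (Q⁻¹ *ᵥ emb y) = emb y := by
      rw [mulVec_mulVec, mul_nonsing_inv _ ((isUnit_iff_isUnit_det Q).1 hQpd.isUnit), one_mulVec]
    have hswap : ∀ x, emb y ⬝ᵥ (Q⁻¹ *ᵥ emb x) = (Q⁻¹ *ᵥ emb y) ⬝ᵥ emb x := fun x => by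
      rw [dotProduct_mulVec, ← mulVec_transpose, ← conjTranspose_eq_transpose_of_trivial,
        hQpd.inv.isHermitian.eq]
    simp only [hswap]
    rw [← dotProduct_sum_smul_vecMulVec_mulVec, ← hQ, hQy]
  have hsplit : (∑ x, p x * g x * (emb y ⬝ᵥ (Q⁻¹ *ᵥ emb x))) - θ ⬝ᵥ emb y =
      ∑ x, p x * (ω x * (emb y ⬝ᵥ (Q⁻¹ *ᵥ emb x))) := by
    rw [← hlin, ← Finset.sum_sub_distrib]
    refine Finset.sum_congr rfl fun x _ => ?_
    rw [hg]
    ring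
  rw [hsplit]
  calc |∑ x, p x * (ω x * (emb y ⬝ᵥ (Q⁻¹ *ᵥ emb x)))|
      ≤ ∑ x, |p x * (ω x * (emb y ⬝ᵥ (Q⁻¹ *ᵥ emb x)))| := Finset.abs_sum_le_sum_abs _ _
    _ ≤ ∑ x, p x * (ε * (Γ / γ)) := by
        refine Finset.sum_le_sum fun x _ => ?_
        rw [abs_mul, abs_mul, abs_of_nonneg (hp0 x)]
        exact mul_le_mul_of_nonneg_left
          (mul_le_mul (hω x) (hoff x) (abs_nonneg _) hε) (hp0 x)
    _ = ε * Γ / γ := by rw [← Finset.sum_mul, hpsum, one_mul, mul_div_assoc]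
end
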